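/- Assume R1 ≠ R2, ‖R1‖ ≤ 1 and ‖R2‖ ≤ 1. If Rb1 × Rb2 ≠ 0 (the target Bloch vectors are linearly independent), then S > 0 and S + T > 0. -/

import Mathlib

noncomputable section

open Real

/-- Euclidean dot product on ℝ³ (vectors as `Fin 3 → ℝ`). -/
def dot3 (v w : Fin 3 → ℝ) : ℝ := v 0 * w 0 + v 1 * w 1 + v 2 * w 2

/-- Cross product on ℝ³. -/
def cross3 (v w : Fin 3 → ℝ) : Fin 3 → ℝ :=
  ![v 1 * w 2 - v 2 * w 1, v 2 * w 0 - v 0 * w 2, v 0 * w 1 - v 1 * w 0]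

/-- Euclidean norm on ℝ³. -/
def norm3 (v : Fin 3 → ℝ) : ℝ := Real.sqrt (dot3 v v)

/-- `T = Σ_{i,j∈{1,2}} (1 − Ri·Rj)(Rbi·Rbj)`. -/
def Tq (R1 R2 Rb1 Rb2 : Fin 3 → ℝ) : ℝ :=
  (1 - dot3 R1 R1) * dot3 Rb1 Rb1 + (1 - dot3 R1 R2) * dot3 Rb1 Rb2
    + (1 - dot3 R2 R1) * dot3 Rb2 Rb1 + (1 - dot3 R2 R2) * dot3 Rb2 Rb2

/-- `S = √(T² + 4·Rbx²·(Rm² − Rx²))`. -/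
def Sq (R1 R2 Rb1 Rb2 : Fin 3 → ℝ) : ℝ :=
  Real.sqrt ((Tq R1 R2 Rb1 Rb2) ^ 2
    + 4 * (norm3 (cross3 Rb1 Rb2)) ^ 2
      * ((norm3 (R1 - R2)) ^ 2 - (norm3 (cross3 R1 R2)) ^ 2))

/-- Indicator function `Ω = S + T − 2·Rbx·Rx`. -/
def Omega (R1 R2 Rb1 Rb2 : Fin 3 → ℝ) : ℝ :=
  Sq R1 R2 Rb1 Rb2 + Tq R1 R2 Rb1 Rb2
    - 2 * norm3 (cross3 Rb1 Rb2) * norm3 (cross3 R1 R2)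

/-- `Ξ = (R1·(R1−R2))(Rb1·(Rb1+Rb2)) + (R2·(R1−R2))(Rb2·(Rb1+Rb2))`. -/
def Xi (R1 R2 Rb1 Rb2 : Fin 3 → ℝ) : ℝ :=
  dot3 R1 (R1 - R2) * dot3 Rb1 (Rb1 + Rb2) + dot3 R2 (R1 - R2) * dot3 Rb2 (Rb1 + Rb2)

/-- `ξ = Rx·Rbp² + Rbx·Rm²`. -/
def xiq (R1 R2 Rb1 Rb2 : Fin 3 → ℝ) : ℝ :=
  norm3 (cross3 R1 R2) * (norm3 (Rb1 + Rb2)) ^ 2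
    + norm3 (cross3 Rb1 Rb2) * (norm3 (R1 - R2)) ^ 2

/-- `Γ_b² = Rbp² − T + 2·Rx·Rbx`. -/
def Gb2 (R1 R2 Rb1 Rb2 : Fin 3 → ℝ) : ℝ :=
  (norm3 (Rb1 + Rb2)) ^ 2 - Tq R1 R2 Rb1 Rb2
    + 2 * norm3 (cross3 R1 R2) * norm3 (cross3 Rb1 Rb2)

lemma dot3_self_nonneg (v : Fin 3 → ℝ) : 0 ≤ dot3 v v := by
  unfold dot3
  nlinarith [sq_nonneg (v 0), sq_nonneg (v 1), sq_nonneg (v 2)]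

lemma dot3_self_pos {v : Fin 3 → ℝ} (hv : v ≠ 0) : 0 < dot3 v v := by
  refine (dot3_self_nonneg v).lt_of_ne' fun h => hv ?_
  unfold dot3 at h
  ext i
  have hi : v i * v i = 0 := by
    fin_cases i <;> simp only [Fin.zero_eta, Fin.mk_one, Fin.reduceFinMk] <;>
      nlinarith [mul_self_nonneg (v 0), mul_self_nonneg (v 1), mul_self_nonneg (v 2)]
  simpa using hi

lemma norm3_sq (v : Fin 3 → ℝ) : norm3 v ^ 2 = dot3 v v :=
  Real.sq_sqrt (dot3_self_nonneg v)

lemma dot3_self_sub (v w : Fin 3 → ℝ) :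
    dot3 (v - w) (v - w) = dot3 v v + dot3 w w - 2 * dot3 v w := by
  simp only [dot3, Pi.sub_apply]
  ring

/-- Lagrange's identity. -/
lemma dot3_self_cross3 (v w : Fin 3 → ℝ) :
    dot3 (cross3 v w) (cross3 v w) = dot3 v v * dot3 w w - dot3 v w ^ 2 := by
  simp only [dot3, cross3, Matrix.cons_val]
  ring

lemma dot3_self_le_one {v : Fin 3 → ℝ} (hv : norm3 v ≤ 1) : dot3 v v ≤ 1 :=
  norm3_sq v ▸ pow_le_one₀ (Real.sqrt_nonneg _) hv

/-- Distinct points of the closed unit ball satisfy `‖v × w‖ < ‖v - w‖`, in squared form. -/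
lemma norm3_cross3_sq_lt {v w : Fin 3 → ℝ} (hne : v ≠ w) (hv : norm3 v ≤ 1)
    (hw : norm3 w ≤ 1) : norm3 (cross3 v w) ^ 2 < norm3 (v - w) ^ 2 := by
  have hd := dot3_self_pos (sub_ne_zero.mpr hne)
  have hv' := dot3_self_le_one hv
  have hw' := dot3_self_le_one hw
  rw [norm3_sq, norm3_sq, dot3_self_cross3]
  rw [dot3_self_sub] at hd ⊢
  rcases hv'.lt_or_eq with h | h
  · nlinarith [mul_pos (sub_pos.mpr h) hd, sq_nonneg (dot3 v v - dot3 v w)]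
  · rw [h] at hd ⊢
    have hc : dot3 v w < 1 := by linarith
    nlinarith [mul_pos (sub_pos.mpr hc) (sub_pos.mpr hc)]

lemma abs_Tq_lt_Sq {R1 R2 Rb1 Rb2 : Fin 3 → ℝ} (hne : R1 ≠ R2)
    (h1 : norm3 R1 ≤ 1) (h2 : norm3 R2 ≤ 1) (hindep : cross3 Rb1 Rb2 ≠ 0) :
    |Tq R1 R2 Rb1 Rb2| < Sq R1 R2 Rb1 Rb2 := by
  refine Real.lt_sqrt_of_sq_lt ?_
  have hb : 0 < norm3 (cross3 Rb1 Rb2) ^ 2 := norm3_sq _ ▸ dot3_self_pos hindep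
  have := mul_pos hb (sub_pos.mpr (norm3_cross3_sq_lt hne h1 h2))
  rw [sq_abs]
  linarith

/-- if `R1 ≠ R2`, `‖R1‖ ≤ 1`, `‖R2‖ ≤ 1` and the target Bloch vectors are
linearly independent (`Rb1 × Rb2 ≠ 0`), then `S > 0` and `S + T > 0`. -/
theorem stmt_1 (R1 R2 Rb1 Rb2 : Fin 3 → ℝ) (hne : R1 ≠ R2)
    (h1 : norm3 R1 ≤ 1) (h2 : norm3 R2 ≤ 1)
    (hindep : cross3 Rb1 Rb2 ≠ 0) :
    0 < Sq R1 R2 Rb1 Rb2 ∧ 0 < Sq R1 R2 Rb1 Rb2 + Tq R1 R2 Rb1 Rb2 := by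
  have h := abs_Tq_lt_Sq hne h1 h2 hindep
  exact ⟨(abs_nonneg _).trans_lt h, by linarith [neg_abs_le (Tq R1 R2 Rb1 Rb2)]⟩
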